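/- Let λ ∈ P^+ and μ, ν ∈ Tλ with μ ∈ P^+. Suppose μ = r_βν for some β ∈ WΠ ∩ Q^+ with β^∨(ν) > 0 and dist(μ, ν) = 1. Then β is a simple imaginary root: β = α_i for some i ∈ I^{im}. -/

import Mathlib

namespace GKM

variable {I V : Type*} [AddCommGroup V] [Module ℚ V]

/-- The simple "reflection" `r_i : x ↦ x - α_i^∨(x) • α_i` (an endomorphism of `h*`). -/
def srefl (α : I → V) (coroot : I → (V →ₗ[ℚ] ℚ)) (i : I) : Module.End ℚ V :=
  LinearMap.id - (coroot i).smulRight (α i)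

/-- The dual map `h ↦ h - h(α_i) • α_i^∨` on linear functionals; for a real index `i`
this is `r_i^∨ : h ↦ h ∘ r_i⁻¹ = h ∘ r_i`. -/
def crefl (α : I → V) (coroot : I → (V →ₗ[ℚ] ℚ)) (i : I) :
    Module.End ℚ (V →ₗ[ℚ] ℚ) :=
  LinearMap.id - (LinearMap.applyₗ (α i)).smulRight (coroot i)

/-- The monoid `T` generated by all the `r_i`, `i ∈ I`. -/
def Tmon (α : I → V) (coroot : I → (V →ₗ[ℚ] ℚ)) : Submonoid (Module.End ℚ V) :=
  Submonoid.closure (Set.range (srefl α coroot))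

/-- The Weyl group `W` generated by the `r_i` with `i` real; since each generator is an
involution, the submonoid it generates coincides with the group it generates. -/
def Wmon (A : I → I → ℤ) (α : I → V) (coroot : I → (V →ₗ[ℚ] ℚ)) :
    Submonoid (Module.End ℚ V) :=
  Submonoid.closure (srefl α coroot '' {i | A i i = 2})

/-- `Q^+`, the set of `ℕ`-linear combinations of simple roots. -/
def Qplus (α : I → V) : Set V :=
  {x | ∃ c : I →₀ ℕ, x = c.sum fun i n => (n : ℚ) • α i}

/-- The weight lattice `P`. -/
def Pint (coroot : I → (V →ₗ[ℚ] ℚ)) : Set V :=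
  {x | ∀ i, ∃ n : ℤ, coroot i x = (n : ℚ)}

/-- The dominant integral weights `P^+`. -/
def Pplus (coroot : I → (V →ₗ[ℚ] ℚ)) : Set V :=
  {x | (∀ i, ∃ n : ℤ, coroot i x = (n : ℚ)) ∧ ∀ i, 0 ≤ coroot i x}

/-- The orbit `Tλ`. -/
def Torbit (α : I → V) (coroot : I → (V →ₗ[ℚ] ℚ)) (lam : V) : Set V :=
  {x | ∃ τ, τ ∈ Tmon α coroot ∧ τ lam = x}

/-- The reduced length of `τ ∈ T` with respect to all generators `r_i`, `i ∈ I`. -/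
noncomputable def lenT (α : I → V) (coroot : I → (V →ₗ[ℚ] ℚ))
    (τ : Module.End ℚ V) : ℕ :=
  sInf {n | ∃ l : List I, l.length = n ∧ (l.map (srefl α coroot)).prod = τ}

/-- The reduced length of `w ∈ W` with respect to the real generators. -/
noncomputable def lenW (A : I → I → ℤ) (α : I → V) (coroot : I → (V →ₗ[ℚ] ℚ))
    (w : Module.End ℚ V) : ℕ :=
  sInf {n | ∃ l : List I, (∀ m ∈ l, A m m = 2) ∧ l.length = n ∧
    (l.map (srefl α coroot)).prod = w}

/-- The reflection `r_β : x ↦ x - β^∨(x) • β` attached to a root/coroot pair. -/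
def reflRoot (β : V) (βv : V →ₗ[ℚ] ℚ) : Module.End ℚ V :=
  LinearMap.id - βv.smulRight β

/-- A presentation of `β = w α_k ∈ WΠ` together with its coroot `β^∨ = w^∨ α_k^∨`,
via a word `l` (with real entries) for `w`. -/
def IsWRootPres (A : I → I → ℤ) (α : I → V) (coroot : I → (V →ₗ[ℚ] ℚ))
    (l : List I) (k : I) (β : V) (βv : V →ₗ[ℚ] ℚ) : Prop :=
  (∀ m ∈ l, A m m = 2) ∧
  β = (l.map (srefl α coroot)).prod (α k) ∧
  βv = (l.map (crefl α coroot)).prod (coroot k)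

/-- `β ∈ WΠ` with coroot `β^∨`. -/
def IsWRootPair (A : I → I → ℤ) (α : I → V) (coroot : I → (V →ₗ[ℚ] ℚ))
    (β : V) (βv : V →ₗ[ℚ] ℚ) : Prop :=
  ∃ l k, IsWRootPres A α coroot l k β βv

/-- A chain `ν =: c s ← ⋯ ← c 0 := μ` of length `s` inside `Tλ`:
`c k = r_{β k} (c (k+1))` with `β k ∈ WΠ ∩ Q^+` and `(β k)^∨(c (k+1)) > 0`. -/
def IsChain (A : I → I → ℤ) (α : I → V) (coroot : I → (V →ₗ[ℚ] ℚ))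
    (lam μ ν : V) (s : ℕ) (c : ℕ → V) (β : ℕ → V)
    (βv : ℕ → (V →ₗ[ℚ] ℚ)) : Prop :=
  c 0 = μ ∧ c s = ν ∧ (∀ k ≤ s, c k ∈ Torbit α coroot lam) ∧
  ∀ k < s, IsWRootPair A α coroot (β k) (βv k) ∧ β k ∈ Qplus α ∧
    0 < βv k (c (k+1)) ∧ c k = c (k+1) - βv k (c (k+1)) • β k

/-- `μ > ν` in `Tλ`. -/
def ChainGT (A : I → I → ℤ) (α : I → V) (coroot : I → (V →ₗ[ℚ] ℚ))
    (lam μ ν : V) : Prop :=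
  ∃ s, 1 ≤ s ∧ ∃ c β βv, IsChain A α coroot lam μ ν s c β βv

/-- `dist(μ, ν) = n`: there is a chain of length `n` from `μ` to `ν` and every chain
has length at most `n`. -/
def distEq (A : I → I → ℤ) (α : I → V) (coroot : I → (V →ₗ[ℚ] ℚ))
    (lam μ ν : V) (n : ℕ) : Prop :=
  (∃ c β βv, IsChain A α coroot lam μ ν n c β βv) ∧
  ∀ m c β βv, IsChain A α coroot lam μ ν m c β βv → m ≤ n

/-- An `a`-chain for `(μ, ν)`: a chain in which each step is a covering
(`dist = 1`), `a·β_k^∨(ν_k)` is a positive integer for steps along `WΠ_re`,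
and `a·β_k^∨(ν_k) = 1` for steps along `WΠ_im`.  The index `ks k` records the simple
root of which `β k` is a `W`-translate. -/
def IsAChain (A : I → I → ℤ) (α : I → V) (coroot : I → (V →ₗ[ℚ] ℚ))
    (lam : V) (a : ℚ) (μ ν : V) (s : ℕ) (c : ℕ → V)
    (β : ℕ → V) (βv : ℕ → (V →ₗ[ℚ] ℚ)) (ks : ℕ → I) : Prop :=
  1 ≤ s ∧ IsChain A α coroot lam μ ν s c β βv ∧
  ∀ k < s,
    (∃ l, IsWRootPres A α coroot l (ks k) (β k) (βv k)) ∧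
    distEq A α coroot lam (c k) (c (k+1)) 1 ∧
    (A (ks k) (ks k) = 2 → ∃ n : ℕ, 0 < n ∧ a * βv k (c (k+1)) = (n : ℚ)) ∧
    (A (ks k) (ks k) ≠ 2 → a * βv k (c (k+1)) = 1)

/-- Existence of an `a`-chain for `(μ, ν)`. -/
def HasAChain (A : I → I → ℤ) (α : I → V) (coroot : I → (V →ₗ[ℚ] ℚ))
    (lam : V) (a : ℚ) (μ ν : V) : Prop :=
  ∃ s c β βv ks, IsAChain A α coroot lam a μ ν s c β βv ks

/-- The piecewise-linear path attached to GLS data `(λ_1, …, λ_s ; a_0, …, a_s)`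
(weights indexed `1, …, s`, breakpoints indexed `0, …, s`):
on `[a_{j-1}, a_j]` it equals `Σ_{k<j} (a_k - a_{k-1}) • λ_k + (t - a_{j-1}) • λ_j`. -/
def glsPath (lamseq : ℕ → V) (a : ℕ → ℚ) (s : ℕ) (t : ℚ) : V :=
  ∑ k ∈ Finset.range s, (max (min t (a (k+1)) - a k) 0) • lamseq (k+1)

/-- The data of a Generalized Lakshmibai–Seshadri path of shape `lam`. -/
def IsGLS (A : I → I → ℤ) (α : I → V) (coroot : I → (V →ₗ[ℚ] ℚ))
    (lam : V) (s : ℕ) (lamseq : ℕ → V) (a : ℕ → ℚ) : Prop :=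
  1 ≤ s ∧ a 0 = 0 ∧ a s = 1 ∧ (∀ k < s, a k < a (k+1)) ∧
  (∀ k, 1 ≤ k → k ≤ s → lamseq k ∈ Torbit α coroot lam) ∧
  (∀ k, 1 ≤ k → k < s →
    HasAChain A α coroot lam (a k) (lamseq k) (lamseq (k+1))) ∧
  (lamseq s = lam ∨ HasAChain A α coroot lam 1 (lamseq s) lam)

/-- The set `ℙ_λ` of Generalized Lakshmibai–Seshadri paths of shape `lam`,
realized as functions `ℚ → V` via `glsPath`. -/
def GLSset (A : I → I → ℤ) (α : I → V) (coroot : I → (V →ₗ[ℚ] ℚ))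
    (lam : V) : Set (ℚ → V) :=
  {π | ∃ s lamseq a, IsGLS A α coroot lam s lamseq a ∧ π = glsPath lamseq a s}

/-- `h_i^π(t) = α_i^∨(π(t))`. -/
def hFun (coroot : I → (V →ₗ[ℚ] ℚ)) (i : I) (π : ℚ → V) (t : ℚ) : ℚ :=
  coroot i (π t)

/-- `m_i^π`, the minimal integer value attained by `h_i^π` on `[0,1]`. -/
noncomputable def mOf (coroot : I → (V →ₗ[ℚ] ℚ)) (i : I) (π : ℚ → V) : ℤ :=
  sInf {n : ℤ | ∃ t, 0 ≤ t ∧ t ≤ 1 ∧ hFun coroot i π t = (n : ℚ)}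

/-- Two paths agree on `[0,1]`. -/
def pathEq (π π' : ℚ → V) : Prop := ∀ t, 0 ≤ t → t ≤ 1 → π t = π' t

/-- `tp = f_+^i(π)`: the largest point of `[0,1]` where `h_i^π` equals `m_i^π`. -/
def IsFPlus (coroot : I → (V →ₗ[ℚ] ℚ)) (i : I) (π : ℚ → V) (tp : ℚ) : Prop :=
  0 ≤ tp ∧ tp ≤ 1 ∧ hFun coroot i π tp = (mOf coroot i π : ℚ) ∧
  ∀ t, 0 ≤ t → t ≤ 1 → hFun coroot i π t = (mOf coroot i π : ℚ) → t ≤ tp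

/-- `tm = f_-^i(π)`: the smallest point of `[tp,1]` where `h_i^π` equals `m_i^π + 1`. -/
def IsFMinus (coroot : I → (V →ₗ[ℚ] ℚ)) (i : I) (π : ℚ → V) (tp tm : ℚ) : Prop :=
  tp ≤ tm ∧ tm ≤ 1 ∧ hFun coroot i π tm = (mOf coroot i π : ℚ) + 1 ∧
  ∀ t, tp ≤ t → t ≤ 1 → hFun coroot i π t = (mOf coroot i π : ℚ) + 1 → tm ≤ t

/-- The path `f_i π` (for cutting data `tp = f_+^i(π)`, `tm = f_-^i(π)`). -/
def fPath (α : I → V) (coroot : I → (V →ₗ[ℚ] ℚ)) (i : I) (tp tm : ℚ)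
    (π : ℚ → V) (t : ℚ) : V :=
  if t ≤ tp then π t
  else if t ≤ tm then π tp + srefl α coroot i (π t - π tp)
  else π t - α i

/-- `π' = f_i π ≠ 0` (equality of paths on `[0,1]`). -/
def FRel (α : I → V) (coroot : I → (V →ₗ[ℚ] ℚ)) (i : I) (π π' : ℚ → V) : Prop :=
  ∃ tp tm, IsFPlus coroot i π tp ∧ tp < 1 ∧ IsFMinus coroot i π tp tm ∧
    pathEq π' (fPath α coroot i tp tm π)

/-- `tp = e_+^i(π)` (`i` real): smallest point of `[0,1]` where `h_i^π = m_i^π`. -/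
def IsEPlusRe (coroot : I → (V →ₗ[ℚ] ℚ)) (i : I) (π : ℚ → V) (tp : ℚ) : Prop :=
  0 ≤ tp ∧ tp ≤ 1 ∧ hFun coroot i π tp = (mOf coroot i π : ℚ) ∧
  ∀ t, 0 ≤ t → t ≤ 1 → hFun coroot i π t = (mOf coroot i π : ℚ) → tp ≤ t

/-- `tm = e_-^i(π)` (`i` real): largest point of `[0,tp]` where `h_i^π = m_i^π + 1`. -/
def IsEMinusRe (coroot : I → (V →ₗ[ℚ] ℚ)) (i : I) (π : ℚ → V) (tp tm : ℚ) : Prop :=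
  0 ≤ tm ∧ tm ≤ tp ∧ hFun coroot i π tm = (mOf coroot i π : ℚ) + 1 ∧
  ∀ t, 0 ≤ t → t ≤ tp → hFun coroot i π t = (mOf coroot i π : ℚ) + 1 → t ≤ tm

/-- The path `e_i π` for `i` real. -/
def ePathRe (α : I → V) (coroot : I → (V →ₗ[ℚ] ℚ)) (i : I) (tm tp : ℚ)
    (π : ℚ → V) (t : ℚ) : V :=
  if t ≤ tm then π t
  else if t ≤ tp then π tm + srefl α coroot i (π t - π tm)
  else π t + α i

/-- `π' = e_i π ≠ 0` for a real index `i`. -/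
def ERelRe (α : I → V) (coroot : I → (V →ₗ[ℚ] ℚ)) (i : I) (π π' : ℚ → V) : Prop :=
  ∃ tp tm, IsEPlusRe coroot i π tp ∧ 0 < tp ∧ IsEMinusRe coroot i π tp tm ∧
    pathEq π' (ePathRe α coroot i tm tp π)

/-- The "inverse reflection" `r_i^{-1} : x ↦ x + (1/(1-a_{ii})) α_i^∨(x) α_i`
for an imaginary index `i`. -/
def rinv (A : I → I → ℤ) (α : I → V) (coroot : I → (V →ₗ[ℚ] ℚ)) (i : I) :
    Module.End ℚ V :=
  LinearMap.id + (1 / (1 - (A i i : ℚ))) • (coroot i).smulRight (α i)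

/-- `tp = e_+^i(π)` (`i` imaginary): smallest point of `[tm,1]` where
`h_i^π = m_i^π + 1 - a_{ii}` (here `tm = e_-^i(π) = f_+^i(π)`). -/
def IsEPlusIm (A : I → I → ℤ) (coroot : I → (V →ₗ[ℚ] ℚ)) (i : I) (π : ℚ → V)
    (tm tp : ℚ) : Prop :=
  tm ≤ tp ∧ tp ≤ 1 ∧
  hFun coroot i π tp = (mOf coroot i π : ℚ) + 1 - (A i i : ℚ) ∧
  ∀ t, tm ≤ t → t ≤ 1 →
    hFun coroot i π t = (mOf coroot i π : ℚ) + 1 - (A i i : ℚ) → tp ≤ t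

/-- The path `e_i π` for `i` imaginary. -/
def ePathIm (A : I → I → ℤ) (α : I → V) (coroot : I → (V →ₗ[ℚ] ℚ)) (i : I)
    (tm tp : ℚ) (π : ℚ → V) (t : ℚ) : V :=
  if t ≤ tm then π t
  else if t ≤ tp then π tm + rinv A α coroot i (π t - π tm)
  else π t + α i

/-- `π' = e_i π ≠ 0` for an imaginary index `i`:  `e_-^i(π) = f_+^i(π) < 1`, the point
`e_+^i(π)` exists, and `h_i^π` never drops to `m_i^π - a_{ii}` on `[e_+^i(π), 1]`. -/
def ERelIm (A : I → I → ℤ) (α : I → V) (coroot : I → (V →ₗ[ℚ] ℚ)) (i : I)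
    (π π' : ℚ → V) : Prop :=
  ∃ tm tp, IsFPlus coroot i π tm ∧ tm < 1 ∧ IsEPlusIm A coroot i π tm tp ∧
    (∀ t, tp ≤ t → t ≤ 1 →
      (mOf coroot i π : ℚ) - (A i i : ℚ) < hFun coroot i π t) ∧
    pathEq π' (ePathIm A α coroot i tm tp π)

/-- `π' = e_i π ≠ 0`. -/
def ERel (A : I → I → ℤ) (α : I → V) (coroot : I → (V →ₗ[ℚ] ℚ)) (i : I)
    (π π' : ℚ → V) : Prop :=
  (A i i = 2 ∧ ERelRe α coroot i π π') ∨ (A i i ≠ 2 ∧ ERelIm A α coroot i π π')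

/-- `π' = f_{i_1} ⋯ f_{i_k} π ≠ 0` for a list `[i_1, …, i_k]` (rightmost acts first). -/
def FMonRel (α : I → V) (coroot : I → (V →ₗ[ℚ] ℚ)) :
    List I → (ℚ → V) → (ℚ → V) → Prop
  | [], π, π' => pathEq π π'
  | i :: l, π, π' => ∃ πm, FMonRel α coroot l π πm ∧ FRel α coroot i πm π'

/-- A generalized crystal for the Borcherds–Cartan datum `(A, α, coroot)`. -/
structure GenCrystal (A : I → I → ℤ) (α : I → V)
    (coroot : I → (V →ₗ[ℚ] ℚ)) where
  B : Type*
  wt : B → V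
  wt_int : ∀ (i : I) (b : B), ∃ n : ℤ, coroot i (wt b) = (n : ℚ)
  eps : I → B → WithBot ℤ
  phi : I → B → WithBot ℤ
  e : I → B → Option B
  f : I → B → Option B
  phi_eq : ∀ (i : I) (b : B) (n : ℤ), (n : ℚ) = coroot i (wt b) →
    phi i b = eps i b + (n : WithBot ℤ)
  wt_e : ∀ (i : I) (b b' : B), e i b = some b' → wt b' = wt b + α i
  eps_e_re : ∀ (i : I) (b b' : B), A i i = 2 → e i b = some b' →
    eps i b' = eps i b + ((-1 : ℤ) : WithBot ℤ)
  eps_e_im : ∀ (i : I) (b b' : B), A i i ≠ 2 → e i b = some b' →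
    eps i b' = eps i b
  e_iff_f : ∀ (i : I) (b b' : B), e i b = some b' ↔ f i b' = some b
  phi_bot : ∀ (i : I) (b : B), phi i b = ⊥ → e i b = none ∧ f i b = none
  eps_im : ∀ (i : I) (b : B), A i i ≠ 2 → eps i b ≤ 0
  phi_im : ∀ (i : I) (b : B), A i i ≠ 2 → phi i b = ⊥ ∨ 0 ≤ phi i b

/-- Finite "orthogonal" subsets of the imaginary simple roots, encoded by their
index sets: `F ∈ 𝒫(Π_im)`. -/
def PImSet (A : I → I → ℤ) (F : Finset I) : Prop :=
  (∀ i ∈ F, A i i ≠ 2) ∧ ∀ i ∈ F, ∀ j ∈ F, i ≠ j → A i j = 0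

end GKM

namespace GKM

/-- Alternately reflecting around a rank-two orbit.  If the orbit is infinite the reflections
leave every bounded region; if it is finite they close up on the other side. -/
lemma rankTwo_closing (S : ℤ → ℤ → Prop) (p q a b N : ℤ) (hp : 0 < p) (hq : 0 < q)
    (ha : 0 ≤ a) (hb : 0 ≤ b) (hab : a = 0 ↔ b = 0)
    (hbound : ∀ s t, S s t → s + t ≤ N)
    (hi : ∀ s t, S s t → 0 < s + t → S (p - s + a * t) t)
    (hj : ∀ s t, S s t → 0 < s + t → S s (q - t + b * s))
    (h0 : S 0 q) : S p 0 := by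
  by_cases h4 : 4 ≤ a * b
  · exfalso
    have ha1 : 0 < a := by
      rcases ha.lt_or_eq with h | h
      · exact h
      · rw [← h] at h4; omega
    have hb1 : 0 < b := by
      rcases hb.lt_or_eq with h | h
      · exact h
      · rw [← h] at h4; omega
    have key : ∀ n : ℕ, ∀ s t, S s t → N - (s + t) ≤ n → 0 < s + t →
        0 < p - 2 * s + a * t → -(a * (q - 2 * t + b * s)) ≤ 2 * (p - 2 * s + a * t) → False := by
      intro n
      induction n with
      | zero =>
        intro s t hS hn hpos hU _
        have h1 := hbound _ _ (hi s t hS hpos)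
        push_cast at hn
        linarith
      | succ n ih =>
        intro s t hS hn hpos hU hUV
        obtain ⟨U, hUdef⟩ : ∃ U, U = p - 2 * s + a * t := ⟨_, rfl⟩
        obtain ⟨X, hXdef⟩ : ∃ X, X = q - 2 * t + b * s := ⟨_, rfl⟩
        rw [← hUdef, ← hXdef] at hUV
        rw [← hUdef] at hU
        have hS1 := hi s t hS hpos
        have e1 : p - s + a * t = s + U := by rw [hUdef]; ring
        rw [e1] at hS1
        have hbU : b * U ≤ 2 * (X + b * U) := by
          have h1 : b * -(a * X) ≤ b * (2 * U) := mul_le_mul_of_nonneg_left hUV hb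
          by_contra hcon
          push Not at hcon
          have hX : 0 < -X := by nlinarith
          nlinarith [mul_le_mul_of_nonneg_right h4 hX.le]
        have hY : 0 < X + b * U := by nlinarith [mul_pos hb1 hU]
        have hS2 := hj _ _ hS1 (by linarith)
        have e2 : q - t + b * (s + U) = t + (X + b * U) := by rw [hXdef]; ring
        rw [e2] at hS2
        have e3 : p - 2 * (s + U) + a * (t + (X + b * U)) = -U + a * (X + b * U) := by
          rw [hUdef]; ring
        have e4 : q - 2 * (t + (X + b * U)) + b * (s + U) = -(X + b * U) := by
          rw [hXdef]; ring
        have hU2 : 2 * U ≤ a * (X + b * U) := by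
          nlinarith [mul_le_mul_of_nonneg_left hbU ha, mul_le_mul_of_nonneg_right h4 hU.le]
        refine ih _ _ hS2 ?_ (by linarith) ?_ ?_
        · push_cast at hn
          linarith
        · rw [e3]; linarith
        · rw [e3, e4]; linarith
    exact key (N - q).toNat 0 q h0 (by have := Int.self_le_toNat (N - q); linarith) (by linarith)
      (by nlinarith [mul_pos ha1 hq]) (by nlinarith [mul_pos ha1 hq])
  · push Not at h4
    have ha3 : a ≤ 3 := by
      by_contra h
      have : 0 < b := by
        rcases hb.lt_or_eq with h' | h'
        · exact h'
        · have := hab.2 h'.symm; omega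
      nlinarith
    have hb3 : b ≤ 3 := by
      by_contra h
      have : 0 < a := by
        rcases ha.lt_or_eq with h' | h'
        · exact h'
        · have := hab.1 h'.symm; omega
      nlinarith
    have hi' : ∀ s t s', S s t → 0 < s + t → s' = p - s + a * t → S s' t := by
      rintro s t _ h1 h2 rfl
      exact hi s t h1 h2
    have hj' : ∀ s t t', S s t → 0 < s + t → t' = q - t + b * s → S s t' := by
      rintro s t _ h1 h2 rfl
      exact hj s t h1 h2
    interval_cases a <;> interval_cases b <;> first | omega | skip
    · have h1 := hi' _ _ p h0 (by omega) (by ring)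
      exact hj' _ _ _ h1 (by omega) (by ring)
    · have h1 := hi' _ _ (p + q) h0 (by omega) (by ring)
      have h2 := hj' _ _ (p + q) h1 (by omega) (by ring)
      have h3 := hi' _ _ p h2 (by omega) (by ring)
      exact hj' _ _ _ h3 (by omega) (by ring)
    · have h1 := hi' _ _ (p + q) h0 (by omega) (by ring)
      have h2 := hj' _ _ (2 * p + 2 * q) h1 (by omega) (by ring)
      have h3 := hi' _ _ (2 * p + q) h2 (by omega) (by ring)
      have h4 := hj' _ _ (2 * p + q) h3 (by omega) (by ring)
      have h5 := hi' _ _ p h4 (by omega) (by ring)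
      exact hj' _ _ _ h5 (by omega) (by ring)
    · have h1 := hi' _ _ (p + q) h0 (by omega) (by ring)
      have h2 := hj' _ _ (3 * p + 3 * q) h1 (by omega) (by ring)
      have h3 := hi' _ _ (3 * p + 2 * q) h2 (by omega) (by ring)
      have h4 := hj' _ _ (6 * p + 4 * q) h3 (by omega) (by ring)
      have h5 := hi' _ _ (4 * p + 2 * q) h4 (by omega) (by ring)
      have h6 := hj' _ _ (6 * p + 3 * q) h5 (by omega) (by ring)
      have h7 := hi' _ _ (3 * p + q) h6 (by omega) (by ring)
      have h8 := hj' _ _ (3 * p + q) h7 (by omega) (by ring)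
      have h9 := hi' _ _ p h8 (by omega) (by ring)
      exact hj' _ _ _ h9 (by omega) (by ring)
    · have h1 := hi' _ _ (p + 2 * q) h0 (by omega) (by ring)
      have h2 := hj' _ _ (p + 2 * q) h1 (by omega) (by ring)
      have h3 := hi' _ _ (2 * p + 2 * q) h2 (by omega) (by ring)
      have h4 := hj' _ _ (p + q) h3 (by omega) (by ring)
      have h5 := hi' _ _ p h4 (by omega) (by ring)
      exact hj' _ _ _ h5 (by omega) (by ring)
    · have h1 := hi' _ _ (p + 3 * q) h0 (by omega) (by ring)
      have h2 := hj' _ _ (p + 3 * q) h1 (by omega) (by ring)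
      have h3 := hi' _ _ (3 * p + 6 * q) h2 (by omega) (by ring)
      have h4 := hj' _ _ (2 * p + 4 * q) h3 (by omega) (by ring)
      have h5 := hi' _ _ (4 * p + 6 * q) h4 (by omega) (by ring)
      have h6 := hj' _ _ (2 * p + 3 * q) h5 (by omega) (by ring)
      have h7 := hi' _ _ (3 * p + 3 * q) h6 (by omega) (by ring)
      have h8 := hj' _ _ (p + q) h7 (by omega) (by ring)
      have h9 := hi' _ _ p h8 (by omega) (by ring)
      exact hj' _ _ _ h9 (by omega) (by ring)

section Orbit

variable {I V : Type*} [AddCommGroup V] [Module ℚ V]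

lemma srefl_apply (α : I → V) (coroot : I → (V →ₗ[ℚ] ℚ)) (i : I) (x : V) :
    srefl α coroot i x = x - coroot i x • α i := by
  simp [srefl]

lemma crefl_apply (α : I → V) (coroot : I → (V →ₗ[ℚ] ℚ)) (i : I) (h : V →ₗ[ℚ] ℚ) (x : V) :
    crefl α coroot i h x = h (srefl α coroot i x) := by
  simp [crefl, srefl, mul_comm]

lemma prod_crefl_apply (α : I → V) (coroot : I → (V →ₗ[ℚ] ℚ)) (l : List I) (h : V →ₗ[ℚ] ℚ)
    (x : V) :
    (l.map (crefl α coroot)).prod h x = h ((l.reverse.map (srefl α coroot)).prod x) := by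
  induction l generalizing x with
  | nil => simp
  | cons i l ih =>
    simp [crefl_apply, ih]

/-- The elements reached from `x₀` by real simple reflections each of which strictly adds a
multiple of a simple root; the index is the total height added. -/
inductive AscOrbit (A : I → I → ℤ) (α : I → V) (coroot : I → (V →ₗ[ℚ] ℚ)) (x₀ : V) :
    ℕ → V → Prop
  | base : AscOrbit A α coroot x₀ 0 x₀
  | step {n : ℕ} {x : V} (i : I) (p : ℕ) (hi : A i i = 2) (hp : 0 < p)
      (hx : AscOrbit A α coroot x₀ n x) (hv : coroot i x = -(p : ℚ)) :
      AscOrbit A α coroot x₀ (n + p) (x + (p : ℚ) • α i)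

/-- `x` is antidominant and integral with respect to the real simple coroots. -/
def IsAntidominant (A : I → I → ℤ) (coroot : I → (V →ₗ[ℚ] ℚ)) (x : V) : Prop :=
  ∀ i, A i i = 2 → ∃ n : ℕ, coroot i x = -(n : ℚ)

variable {A : I → I → ℤ} {α : I → V} {coroot : I → (V →ₗ[ℚ] ℚ)} {x₀ : V}

lemma srefl_srefl (hpair : ∀ i j, coroot i (α j) = (A i j : ℚ)) {i : I} (hi : A i i = 2)
    (x : V) : srefl α coroot i (srefl α coroot i x) = x := by
  simp only [srefl_apply, map_sub, map_smul, hpair, hi]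
  module

lemma prod_srefl_reverse (hpair : ∀ i j, coroot i (α j) = (A i j : ℚ)) (l : List I)
    (hl : ∀ m ∈ l, A m m = 2) (x : V) :
    (l.reverse.map (srefl α coroot)).prod ((l.map (srefl α coroot)).prod x) = x := by
  induction l generalizing x with
  | nil => simp
  | cons i l ih =>
    have h1 := ih (fun m hm => hl m (by simp [hm]))
    simp only [List.map_reverse] at h1
    simp [srefl_srefl hpair (hl i (by simp)), h1]

lemma prod_srefl_reverse' (hpair : ∀ i j, coroot i (α j) = (A i j : ℚ)) (l : List I)
    (hl : ∀ m ∈ l, A m m = 2) (x : V) :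
    (l.map (srefl α coroot)).prod ((l.reverse.map (srefl α coroot)).prod x) = x := by
  have := prod_srefl_reverse hpair l.reverse (fun m hm => hl m (by simpa using hm)) x
  simpa using this

lemma AscOrbit.exists_int (hpair : ∀ i j, coroot i (α j) = (A i j : ℚ))
    (h₀ : IsAntidominant A coroot x₀) {n : ℕ} {x : V} (hx : AscOrbit A α coroot x₀ n x)
    (i : I) (hi : A i i = 2) : ∃ m : ℤ, coroot i x = m := by
  induction hx with
  | base =>
    obtain ⟨m, hm⟩ := h₀ i hi
    exact ⟨-m, by simp [hm]⟩
  | step j p _ _ _ _ ih =>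
    obtain ⟨m, hm⟩ := ih
    exact ⟨m + p * A i j, by simp [hm, hpair]⟩

/-- The set reached by ascending reflections is stable under descending ones. -/
lemma AscOrbit.descend (hpair : ∀ i j, coroot i (α j) = (A i j : ℚ))
    (hoff : ∀ i j, i ≠ j → A i j ≤ 0) (hzero : ∀ i j, A i j = 0 ↔ A j i = 0)
    (h₀ : IsAntidominant A coroot x₀) (N : ℕ) :
    ∀ x, AscOrbit A α coroot x₀ N x → ∀ (i : I) (p : ℕ), A i i = 2 → 0 < p →
      coroot i x = p → ∃ n, n + p = N ∧ AscOrbit A α coroot x₀ n (x - (p : ℚ) • α i) := by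
  induction N using Nat.strong_induction_on with
  | _ N ih =>
  intro x hx i p hi hp hpx
  cases hx with
  | base =>
    obtain ⟨m, hm⟩ := h₀ i hi
    have h1 : (0 : ℚ) < p := by exact_mod_cast hp
    have h2 : (0 : ℚ) ≤ m := by positivity
    linarith
  | @step n y j q hj hq hy hqy =>
    by_cases hij : i = j
    · subst hij
      have hpq : (p : ℚ) = q := by
        rw [← hpx]
        simp only [map_add, map_smul, hqy, hpair, hi, smul_eq_mul]
        push_cast
        ring
      have hpq' : p = q := by exact_mod_cast hpq
      subst hpq'
      exact ⟨n, rfl, by simpa using hy⟩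
    · obtain ⟨x, hxdef⟩ : ∃ x, x = y + (q : ℚ) • α j := ⟨_, rfl⟩
      rw [← hxdef] at hpx ⊢
      have hqx : coroot j x = q := by
        rw [hxdef]
        simp only [map_add, map_smul, hqy, hpair, hj, smul_eq_mul]
        push_cast
        ring
      obtain ⟨a, ha⟩ : ∃ a, a = -A i j := ⟨_, rfl⟩
      obtain ⟨b, hb⟩ : ∃ b, b = -A j i := ⟨_, rfl⟩
      have haq : (A i j : ℚ) = -a := by rw [ha]; push_cast; ring
      have hbq : (A j i : ℚ) = -b := by rw [hb]; push_cast; ring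
      let S : ℤ → ℤ → Prop := fun s t => ∃ m : ℕ, (m : ℤ) + s + t = n + q ∧
        AscOrbit A α coroot x₀ m (x - (s : ℚ) • α i - (t : ℚ) • α j)
      have move : ∀ (k : I) (s t s' t' u : ℤ), A k k = 2 → 0 < s + t → S s t →
          coroot k (x - (s : ℚ) • α i - (t : ℚ) • α j) = u →
          x - (s : ℚ) • α i - (t : ℚ) • α j - (u : ℚ) • α k
            = x - (s' : ℚ) • α i - (t' : ℚ) • α j →
          s' + t' = s + t + u → S s' t' := by
        rintro k s t s' t' u hk hst ⟨m, hm, hR⟩ hu hx' hsum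
        rcases lt_trichotomy u 0 with hneg | hzer | hposu
        · obtain ⟨v, rfl⟩ : ∃ v : ℕ, u = -v := ⟨u.natAbs, by omega⟩
          refine ⟨m + v, by push_cast; omega, ?_⟩
          rw [← hx']
          have := AscOrbit.step k v hk (by omega) hR (by rw [hu]; push_cast; ring)
          convert this using 1
          push_cast
          module
        · subst hzer
          refine ⟨m, by omega, ?_⟩
          rw [← hx']
          simpa using hR
        · obtain ⟨v, rfl⟩ : ∃ v : ℕ, u = v := ⟨u.natAbs, by omega⟩
          obtain ⟨m', hm', hR'⟩ := ih m (by omega) _ hR k v hk (by omega) (by rw [hu]; simp)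
          refine ⟨m', by omega, ?_⟩
          rw [← hx']
          simpa using hR'
      have hclose : S p 0 := by
        refine rankTwo_closing S p q a b (n + q) (by omega) (by omega) ?_ ?_ ?_ ?_ ?_ ?_ ?_
        · have := hoff i j hij; omega
        · have := hoff j i (Ne.symm hij); omega
        · have := hzero i j; omega
        · rintro s t ⟨m, hm, -⟩
          omega
        · intro s t hS hst
          refine move i s t _ t (p - 2 * s + a * t) hi hst hS ?_ ?_ (by ring)
          · simp only [map_sub, map_smul, hpx, hpair, hi, haq, smul_eq_mul]
            push_cast
            ring
          · push_cast
            module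
        · intro s t hS hst
          refine move j s t s _ (q - 2 * t + b * s) hj hst hS ?_ ?_ (by ring)
          · simp only [map_sub, map_smul, hqx, hpair, hj, hbq, smul_eq_mul]
            push_cast
            ring
          · push_cast
            module
        · refine ⟨n, by ring, ?_⟩
          rw [hxdef]
          simpa using hy
      obtain ⟨m, hm, hR⟩ := hclose
      exact ⟨m, by omega, by simpa using hR⟩

lemma AscOrbit.srefl (hpair : ∀ i j, coroot i (α j) = (A i j : ℚ))
    (hoff : ∀ i j, i ≠ j → A i j ≤ 0) (hzero : ∀ i j, A i j = 0 ↔ A j i = 0)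
    (h₀ : IsAntidominant A coroot x₀) {n : ℕ} {x : V} (hx : AscOrbit A α coroot x₀ n x)
    (i : I) (hi : A i i = 2) : ∃ m, AscOrbit A α coroot x₀ m (GKM.srefl α coroot i x) := by
  obtain ⟨u, hu⟩ := hx.exists_int hpair h₀ i hi
  rw [srefl_apply, hu]
  rcases lt_trichotomy u 0 with hneg | rfl | hpos
  · obtain ⟨v, rfl⟩ : ∃ v : ℕ, u = -v := ⟨u.natAbs, by omega⟩
    refine ⟨n + v, ?_⟩
    have := AscOrbit.step i v hi (by omega) hx (by rw [hu]; push_cast; ring)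
    convert this using 1
    push_cast
    module
  · exact ⟨n, by simpa using hx⟩
  · obtain ⟨v, rfl⟩ : ∃ v : ℕ, u = v := ⟨u.natAbs, by omega⟩
    obtain ⟨m, -, hm⟩ := AscOrbit.descend hpair hoff hzero h₀ n x hx i v hi (by omega)
      (by rw [hu]; simp)
    exact ⟨m, by simpa using hm⟩

/-- The whole Weyl group orbit of an antidominant element is reached by ascending reflections. -/
lemma ascOrbit_prod (hpair : ∀ i j, coroot i (α j) = (A i j : ℚ))
    (hoff : ∀ i j, i ≠ j → A i j ≤ 0) (hzero : ∀ i j, A i j = 0 ↔ A j i = 0)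
    (h₀ : IsAntidominant A coroot x₀) (l : List I) (hl : ∀ m ∈ l, A m m = 2) :
    ∃ n, AscOrbit A α coroot x₀ n ((l.map (GKM.srefl α coroot)).prod x₀) := by
  induction l with
  | nil => exact ⟨0, by simpa using AscOrbit.base⟩
  | cons i l ih =>
    obtain ⟨n, hn⟩ := ih (fun m hm => hl m (by simp [hm]))
    simpa using hn.srefl hpair hoff hzero h₀ i (hl i (by simp))

lemma zero_mem_Qplus : (0 : V) ∈ Qplus α := ⟨0, by simp⟩

lemma add_smul_mem_Qplus {x : V} (hx : x ∈ Qplus α) (p : ℕ) (i : I) :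
    x + (p : ℚ) • α i ∈ Qplus α := by
  classical
  obtain ⟨c, rfl⟩ := hx
  refine ⟨c + Finsupp.single i p, ?_⟩
  rw [Finsupp.sum_add_index (by simp) (by intros; push_cast; rw [add_smul]),
    Finsupp.sum_single_index (by simp)]

lemma simple_mem_Qplus (i : I) : α i ∈ Qplus α := by
  simpa using add_smul_mem_Qplus (zero_mem_Qplus (α := α)) 1 i

lemma AscOrbit.sub_mem_Qplus {n : ℕ} {x : V} (hx : AscOrbit A α coroot x₀ n x) :
    x - x₀ ∈ Qplus α := by
  induction hx with
  | base => simpa using zero_mem_Qplus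
  | step i p _ _ _ _ ih =>
    have := add_smul_mem_Qplus ih p i
    rwa [sub_add_eq_add_sub] at this

lemma AscOrbit.mem_Qplus (h : x₀ ∈ Qplus α) {n : ℕ} {x : V}
    (hx : AscOrbit A α coroot x₀ n x) : x ∈ Qplus α := by
  induction hx with
  | base => exact h
  | step i p _ _ _ _ ih => exact add_smul_mem_Qplus ih p i

lemma AscOrbit.coroot_le (hpair : ∀ i j, coroot i (α j) = (A i j : ℚ))
    (hoff : ∀ i j, i ≠ j → A i j ≤ 0) {n : ℕ} {x : V} (hx : AscOrbit A α coroot x₀ n x)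
    (k : I) (hk : A k k ≠ 2) : coroot k x ≤ coroot k x₀ := by
  induction hx with
  | base => exact le_rfl
  | step i p hi _ _ _ ih =>
    have hki : (A k i : ℚ) ≤ 0 := by
      exact_mod_cast hoff k i (by rintro rfl; exact hk hi)
    have hp : (0 : ℚ) ≤ p := by positivity
    simp only [map_add, map_smul, hpair, smul_eq_mul]
    nlinarith

lemma AscOrbit.eq_or_coroot_le (hpair : ∀ i j, coroot i (α j) = (A i j : ℚ))
    (hoff : ∀ i j, i ≠ j → A i j ≤ 0) (hzero : ∀ i j, A i j = 0 ↔ A j i = 0)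
    (k : I) (hk : A k k ≠ 2) {n : ℕ} {x : V} (hx : AscOrbit A α coroot (α k) n x) :
    x = α k ∨ coroot k x ≤ A k k - 1 := by
  induction hx with
  | base => exact Or.inl rfl
  | @step n x i p hi hp hx hv ih =>
    right
    have hki := hoff k i (by rintro rfl; exact hk hi)
    have hp' : (1 : ℚ) ≤ p := by exact_mod_cast hp
    have hkiq : (A k i : ℚ) ≤ 0 := by exact_mod_cast hki
    simp only [map_add, map_smul, hpair, smul_eq_mul]
    rcases ih with rfl | h
    · have hne : A k i ≠ 0 := by
        rw [Ne, hzero k i]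
        intro h0
        rw [hpair, h0] at hv
        push_cast at hv
        linarith
      have hki1 : (A k i : ℚ) ≤ -1 := by exact_mod_cast (by omega : A k i ≤ -1)
      rw [hpair]
      nlinarith
    · nlinarith

lemma isAntidominant_simple (hpair : ∀ i j, coroot i (α j) = (A i j : ℚ))
    (hoff : ∀ i j, i ≠ j → A i j ≤ 0) (k : I) (hk : A k k ≠ 2) :
    IsAntidominant A coroot (α k) := by
  intro i hi
  have := hoff i k (by rintro rfl; exact hk hi)
  refine ⟨(-A i k).toNat, ?_⟩
  have h : (((-A i k).toNat : ℤ) : ℚ) = ((-A i k : ℤ) : ℚ) := by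
    rw [Int.toNat_of_nonneg (by omega)]
  rw [hpair]
  push_cast at h
  rw [h]
  ring

lemma isAntidominant_neg {x : V} (hx : x ∈ Pplus coroot) : IsAntidominant A coroot (-x) := by
  intro i _
  obtain ⟨m, hm⟩ := hx.1 i
  have h0 := hx.2 i
  rw [hm] at h0
  have h0' : 0 ≤ m := by exact_mod_cast h0
  obtain ⟨v, rfl⟩ : ∃ v : ℕ, m = v := ⟨m.natAbs, by omega⟩
  exact ⟨v, by simp [hm]⟩

/-- Imaginary simple coroots do not decrease along the Weyl orbit of a dominant weight. -/
lemma coroot_le_coroot_prod (hpair : ∀ i j, coroot i (α j) = (A i j : ℚ))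
    (hoff : ∀ i j, i ≠ j → A i j ≤ 0) (hzero : ∀ i j, A i j = 0 ↔ A j i = 0)
    {x : V} (hx : x ∈ Pplus coroot) (k : I) (hk : A k k ≠ 2) (l : List I)
    (hl : ∀ m ∈ l, A m m = 2) :
    coroot k x ≤ coroot k ((l.map (srefl α coroot)).prod x) := by
  obtain ⟨n, hn⟩ := ascOrbit_prod hpair hoff hzero (isAntidominant_neg hx) l hl
  have := hn.coroot_le hpair hoff k hk
  simp only [map_neg] at this
  linarith

/-- Imaginary simple coroots are nonnegative on the `T`-orbit of a dominant weight. -/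
lemma coroot_nonneg_of_mem_Torbit (hpair : ∀ i j, coroot i (α j) = (A i j : ℚ))
    (hdiag : ∀ i, A i i = 2 ∨ A i i ≤ 0)
    (hoff : ∀ i j, i ≠ j → A i j ≤ 0) (hzero : ∀ i j, A i j = 0 ↔ A j i = 0)
    {lam x : V} (hlam : lam ∈ Pplus coroot) (hx : x ∈ Torbit α coroot lam)
    (k : I) (hk : A k k ≠ 2) : 0 ≤ coroot k x := by
  obtain ⟨τ, hτ, rfl⟩ := hx
  suffices h : ∀ (l : List I), (∀ m ∈ l, A m m = 2) → ∀ k, A k k ≠ 2 →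
      0 ≤ coroot k ((l.map (srefl α coroot)).prod (τ lam)) by
    simpa using h [] (by simp) k hk
  unfold Tmon at hτ
  induction hτ using Submonoid.closure_induction_left with
  | one =>
    intro l hl k hk
    exact (hlam.2 k).trans (coroot_le_coroot_prod hpair hoff hzero hlam k hk l hl)
  | mul_left r hr τ _ ih =>
    obtain ⟨j, rfl⟩ := hr
    intro l hl k hk
    by_cases hj : A j j = 2
    · have := ih (l ++ [j]) (by simpa [or_imp, forall_and, hj] using hl) k hk
      simpa using this
    · have hs := ih [] (by simp) j hj
      have h1 := ih l hl k hk
      obtain ⟨n, hn⟩ := ascOrbit_prod hpair hoff hzero (isAntidominant_simple hpair hoff j hj) l hl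
      have h2 := hn.coroot_le hpair hoff k hk
      have h3 : (A k j : ℚ) ≤ 0 := by
        by_cases hkj : k = j
        · subst hkj
          exact_mod_cast (hdiag k).resolve_left hk
        · exact_mod_cast hoff k j hkj
      rw [hpair] at h2
      simp only [List.map_nil, List.prod_nil, Module.End.one_apply] at hs
      simp only [Module.End.mul_apply, srefl_apply, map_sub, map_smul, smul_eq_mul]
      nlinarith

lemma srefl_mem_Torbit {lam x : V} (hx : x ∈ Torbit α coroot lam) (i : I) :
    srefl α coroot i x ∈ Torbit α coroot lam := by
  obtain ⟨τ, hτ, rfl⟩ := hx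
  exact ⟨srefl α coroot i * τ, mul_mem (Submonoid.subset_closure ⟨i, rfl⟩) hτ, rfl⟩

lemma eq_zero_of_mem_Qplus (hind : LinearIndependent ℚ α) {x : V} (hx : x ∈ Qplus α) {c : ℚ}
    (hc : 0 < c) (hneg : -(c • x) ∈ Qplus α) : x = 0 := by
  classical
  obtain ⟨m, rfl⟩ := hx
  obtain ⟨d, hd⟩ := hneg
  have key := linearIndependent_iff.1 hind
    (c • m.mapRange (Nat.cast : ℕ → ℚ) Nat.cast_zero + d.mapRange Nat.cast Nat.cast_zero) (by
      rw [map_add, map_smul, Finsupp.linearCombination_apply, Finsupp.linearCombination_apply,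
        Finsupp.sum_mapRange_index (by simp), Finsupp.sum_mapRange_index (by simp), ← hd]
      simp)
  have hm : m = 0 := by
    ext i
    have h := DFunLike.congr_fun key i
    simp only [Finsupp.add_apply, Finsupp.smul_apply, Finsupp.mapRange_apply, smul_eq_mul,
      Finsupp.zero_apply] at h
    have h1 : (0 : ℚ) ≤ d i := by positivity
    have h2 : (0 : ℚ) ≤ m i := by positivity
    have h3 : (m i : ℚ) = 0 := by nlinarith
    simpa using h3
  simp [hm]

/-- A reflection in a positive real root cannot raise a weight to a dominant one. -/
lemma not_real_of_refl_dominant (hind : LinearIndependent ℚ α)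
    (hpair : ∀ i j, coroot i (α j) = (A i j : ℚ))
    (hoff : ∀ i j, i ≠ j → A i j ≤ 0) (hzero : ∀ i j, A i j = 0 ↔ A j i = 0)
    {μ ν β : V} {βv : V →ₗ[ℚ] ℚ} {l : List I} {k : I}
    (hpres : IsWRootPres A α coroot l k β βv) (hμP : μ ∈ Pplus coroot) (hQ : β ∈ Qplus α)
    (hpos : 0 < βv ν) (hrefl : μ = ν - βv ν • β) : A k k ≠ 2 := by
  intro hk
  obtain ⟨hl, hβ, hβv⟩ := hpres
  have hinv : (l.reverse.map (srefl α coroot)).prod β = α k := by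
    rw [hβ, prod_srefl_reverse hpair l hl]
  have hββ : βv β = 2 := by
    rw [hβv, prod_crefl_apply, hinv, hpair, hk]
    norm_num
  have hβμ : βv μ = -βv ν := by
    conv_lhs => rw [hrefl]
    simp only [map_sub, map_smul, hββ, smul_eq_mul]
    ring
  obtain ⟨n, hn⟩ := ascOrbit_prod (α := α) hpair hoff hzero
    (isAntidominant_neg (A := A) hμP) (l ++ [k] ++ l.reverse) (by
      intro m hm
      simp only [List.mem_append, List.mem_singleton, List.mem_reverse] at hm
      rcases hm with (hm | rfl) | hm
      · exact hl m hm
      · exact hk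
      · exact hl m hm)
  have hν : ((l ++ [k] ++ l.reverse).map (srefl α coroot)).prod (-μ) = -ν := by
    have h1 : coroot k ((l.reverse.map (srefl α coroot)).prod μ) = βv μ := by
      rw [hβv, prod_crefl_apply]
    rw [List.map_append, List.map_append, List.prod_append, List.prod_append]
    simp only [Module.End.mul_apply, List.map_singleton, List.prod_singleton, srefl_apply, map_neg,
      map_sub, map_smul, h1, prod_srefl_reverse' hpair l hl, ← hβ, hβμ]
    conv_lhs => rw [hrefl]
    module
  rw [hν] at hn
  have h1 := hn.sub_mem_Qplus
  have h2 : -ν - -μ = -(βv ν • β) := by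
    rw [hrefl]
    module
  rw [h2] at h1
  have h3 := eq_zero_of_mem_Qplus hind hQ hpos h1
  rw [h3, map_zero] at hββ
  norm_num at hββ

end Orbit

end GKM

open GKM in
/-- If `μ ∈ Tλ ∩ P^+`, `ν ∈ Tλ`, `μ = r_β ν` with `β ∈ WΠ ∩ Q^+`, `β^∨(ν) > 0` and
`dist(μ, ν) = 1`, then `β` is a simple imaginary root. -/
theorem stmt10 {I V : Type*} [Countable I] [AddCommGroup V] [Module ℚ V]
    (A : I → I → ℤ) (α : I → V) (coroot : I → (V →ₗ[ℚ] ℚ))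
    (hind : LinearIndependent ℚ α)
    (hpair : ∀ i j, coroot i (α j) = (A i j : ℚ))
    (hdiag : ∀ i, A i i = 2 ∨ A i i ≤ 0)
    (hoff : ∀ i j, i ≠ j → A i j ≤ 0)
    (hzero : ∀ i j, A i j = 0 ↔ A j i = 0)
    (lam : V) (hlam : lam ∈ Pplus coroot)
    (μ ν : V) (hμT : μ ∈ Torbit α coroot lam) (hμP : μ ∈ Pplus coroot)
    (hνT : ν ∈ Torbit α coroot lam)
    (β : V) (βv : V →ₗ[ℚ] ℚ)
    (hroot : IsWRootPair A α coroot β βv) (hQ : β ∈ Qplus α)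
    (hpos : 0 < βv ν) (hrefl : μ = ν - βv ν • β)
    (hdist : distEq A α coroot lam μ ν 1) :
    ∃ i : I, A i i ≠ 2 ∧ β = α i := by
  obtain ⟨l, k, hpres⟩ := hroot
  have hk := not_real_of_refl_dominant hind hpair hoff hzero hpres hμP hQ hpos hrefl
  obtain ⟨hl, hβ, hβv⟩ := hpres
  refine ⟨k, hk, ?_⟩
  by_contra hne
  have h₀ := isAntidominant_simple hpair hoff k hk
  have hinv : (l.reverse.map (srefl α coroot)).prod β = α k := by
    rw [hβ, prod_srefl_reverse hpair l hl]
  have hββ : βv β = A k k := by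
    rw [hβv, prod_crefl_apply, hinv, hpair]
  have hβμ : βv μ = βv ν * (1 - A k k) := by
    conv_lhs => rw [hrefl]
    simp only [map_sub, map_smul, hββ, smul_eq_mul]
    ring
  obtain ⟨n, hn⟩ := ascOrbit_prod hpair hoff hzero h₀ l hl
  rw [← hβ] at hn
  have hkβ := (hn.eq_or_coroot_le hpair hoff hzero k hk).resolve_left hne
  -- a real simple root which can be split off from `β`
  obtain ⟨i, p, hi, hp, hiβ, m, hm⟩ : ∃ (i : I) (p : ℕ), A i i = 2 ∧ 0 < p ∧ coroot i β = p ∧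
      ∃ m, AscOrbit A α coroot (α k) m (srefl α coroot i β) := by
    cases hn with
    | base => exact absurd rfl hne
    | @step n y i p hi hp hy hv =>
      have hval : coroot i (y + (p : ℚ) • α i) = p := by
        simp only [map_add, map_smul, hv, hpair, hi, smul_eq_mul]
        push_cast
        ring
      refine ⟨i, p, hi, hp, hval, n, ?_⟩
      rw [srefl_apply, hval]
      simpa using hy
  have hpq : (0 : ℚ) < p := by exact_mod_cast hp
  have hrev : ∀ j ∈ l.reverse, A j j = 2 := fun j hj => hl j (by simpa using hj)
  have hβvi : 0 < βv (α i) := by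
    obtain ⟨n', hn'⟩ := ascOrbit_prod hpair hoff hzero h₀ (l.reverse ++ [i] ++ l) (by
      intro j hj
      simp only [List.mem_append, List.mem_singleton, List.mem_reverse] at hj
      rcases hj with (hj | rfl) | hj
      · exact hl j hj
      · exact hi
      · exact hl j hj)
    rw [List.map_append, List.map_append, List.prod_append, List.prod_append] at hn'
    simp only [Module.End.mul_apply, List.map_singleton, List.prod_singleton, ← hβ] at hn'
    rcases hn'.eq_or_coroot_le hpair hoff hzero k hk with h | h
    · exfalso
      have h2 := congrArg (l.map (srefl α coroot)).prod h
      rw [prod_srefl_reverse' hpair l hl, ← hβ, srefl_apply, hiβ] at h2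
      have h3 := congrArg (coroot i) h2
      simp only [map_sub, map_smul, hiβ, hpair, hi, smul_eq_mul] at h3
      push_cast at h3
      linarith
    · rw [← prod_crefl_apply, ← hβv, srefl_apply, hiβ, map_sub, map_smul, hββ, smul_eq_mul] at h
      by_contra hcon
      push Not at hcon
      nlinarith
  have hiμ : coroot i μ = 0 := by
    have hνk := coroot_nonneg_of_mem_Torbit hpair hdiag hoff hzero hlam hνT k hk
    have hμk : coroot k μ = coroot k ν - βv ν * coroot k β := by
      conv_lhs => rw [hrefl]
      simp
    have h1 := coroot_le_coroot_prod hpair hoff hzero hμP k hk (l.reverse ++ [i]) (by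
      intro j hj
      simp only [List.mem_append, List.mem_singleton] at hj
      rcases hj with hj | rfl
      · exact hrev j hj
      · exact hi)
    rw [List.map_append, List.prod_append, List.map_singleton, List.prod_singleton,
      Module.End.mul_apply, ← prod_crefl_apply, ← hβv, srefl_apply, map_sub, map_smul, hβμ,
      smul_eq_mul] at h1
    have h2 := hμP.2 i
    have h3 : coroot i μ * βv (α i) ≤ 0 := by nlinarith
    nlinarith
  have hiν : 0 < coroot i ν := by
    have h1 : coroot i μ = coroot i ν - βv ν * coroot i β := by
      conv_lhs => rw [hrefl]
      simp
    rw [hiμ, hiβ] at h1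
    nlinarith [mul_pos hpos hpq]
  have hval : crefl α coroot i βv (srefl α coroot i ν) = βv ν := by
    rw [crefl_apply, srefl_srefl hpair hi]
  have hsμ : μ = srefl α coroot i ν - βv ν • srefl α coroot i β := by
    rw [← map_smul, ← map_sub, ← hrefl, srefl_apply, hiμ]
    simp
  have hlen := hdist.2 2 (fun j => if j = 0 then μ else if j = 1 then srefl α coroot i ν else ν)
    (fun j => if j = 0 then srefl α coroot i β else α i)
    (fun j => if j = 0 then crefl α coroot i βv else coroot i) (by
      refine ⟨rfl, rfl, ?_, ?_⟩
      · intro j hj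
        interval_cases j
        · exact hμT
        · exact srefl_mem_Torbit hνT i
        · exact hνT
      · intro j hj
        interval_cases j
        · refine ⟨⟨i :: l, k, ?_, ?_, ?_⟩, hm.mem_Qplus (simple_mem_Qplus k), ?_, ?_⟩
          · simpa [hi] using hl
          · simp [hβ]
          · simp [hβv]
          · simpa [hval] using hpos
          · simpa [hval] using hsμ
        · refine ⟨⟨[], i, ?_, ?_, ?_⟩, simple_mem_Qplus i, ?_, ?_⟩
          · simp
          · simp
          · simp
          · simpa using hiν
          · simp [srefl_apply])
  omega
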